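/- If M ≺ H_θ is an ℵ₀-guessing model, then for every regular cardinal λ ∈ M with κ_M < λ < θ, the set M ∩ λ is bounded in λ. -/

import Mathlib

open Cardinal

namespace GuessingModels

/-- First-order formulas in the language of set theory (membership and equality),
with `n` free variables. -/
inductive SF : ℕ → Type
  | mem {n} (i j : Fin n) : SF n
  | eq {n} (i j : Fin n) : SF n
  | imp {n} (f g : SF n) : SF n
  | not {n} (f : SF n) : SF n
  | ex {n} (f : SF (n + 1)) : SF n

/-- Tarskian satisfaction of a set-theoretic formula in the structure `⟨S, ∈⟩`,
where `S` is a class of ZF sets. -/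
def Realize (S : Set ZFSet) : ∀ {n}, SF n → (Fin n → ZFSet) → Prop
  | _, .mem i j, v => v i ∈ v j
  | _, .eq i j, v => v i = v j
  | _, .imp f g, v => Realize S f v → Realize S g v
  | _, .not f, v => ¬ Realize S f v
  | _, .ex f, v => ∃ x ∈ S, Realize S f (Fin.cons x v)

/-- `M ≺ R` : `M` is an elementary substructure of `⟨R, ∈⟩`. -/
def Prec (M R : Set ZFSet) : Prop :=
  M ⊆ R ∧ ∀ {n : ℕ} (φ : SF n) (v : Fin n → ZFSet), (∀ i, v i ∈ M) →
    (Realize M φ v ↔ Realize R φ v)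

/-- A (von Neumann) ordinal: a transitive set of transitive sets. -/
def IsOrd (x : ZFSet) : Prop :=
  x.IsTransitive ∧ ∀ y ∈ x, ZFSet.IsTransitive y

/-- `≤` on ordinals, i.e. `∈` or `=`. -/
def ole (a b : ZFSet) : Prop := a ∈ b ∨ a = b

/-- The cardinality of (the extension of) a ZF set. -/
noncomputable def card (x : ZFSet) : Cardinal := Cardinal.mk x.toSet

/-- A ZF set which is a cardinal: an ordinal not equinumerous with any of its members. -/
def IsCard (κ : ZFSet) : Prop := IsOrd κ ∧ ∀ β ∈ κ, card β < card κ

/-- `s` (an external class) is a cofinal subset of the ordinal `κ`. -/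
def CofinalSetIn (s : Set ZFSet) (κ : ZFSet) : Prop :=
  (∀ x ∈ s, x ∈ κ) ∧ ∀ β ∈ κ, ∃ γ ∈ s, ole β γ

/-- A regular cardinal: an infinite cardinal all of whose cofinal subsets have full size. -/
def IsRegCard (κ : ZFSet) : Prop :=
  IsCard κ ∧ ZFSet.omega ⊆ κ ∧
    ∀ s : Set ZFSet, CofinalSetIn s κ → Cardinal.mk s = card κ

/-- A strong limit ZF cardinal. -/
def IsStrongLimit (κ : ZFSet) : Prop := ∀ β ∈ κ, (2 : Cardinal) ^ card β < card κ

/-- A strongly inaccessible cardinal: regular, uncountable and strong limit. -/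
def IsInacc (κ : ZFSet) : Prop := IsRegCard κ ∧ ZFSet.omega ∈ κ ∧ IsStrongLimit κ

/-- The transitive closure of a ZF set, as a class. -/
def tcl (x : ZFSet) : Set ZFSet := {y | Relation.TransGen (· ∈ ·) y x}

/-- `H_θ` : the class of sets hereditarily of size `< θ`. -/
noncomputable def HSet (θ : ZFSet) : Set ZFSet := {x | Cardinal.mk (tcl x) < card θ}

/-- `V_α` as a class, for `α` an ordinal (as a ZF set): sets of rank `< α`. -/
noncomputable def VSet (α : ZFSet) : Set ZFSet := {x | x.rank < α.rank}

/-- A suitable initial segment: `H_θ` for a regular cardinal `θ`, or a rank initial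
segment `V_α`. -/
def Suitable (R : Set ZFSet) : Prop :=
  (∃ θ : ZFSet, IsRegCard θ ∧ R = HSet θ) ∨ (∃ α : ZFSet, IsOrd α ∧ R = VSet α)

/-- `κ = κ_M` : `κ` is the least ordinal in `M` with `M ∩ κ ≠ κ`. -/
def KappaSpec (M : Set ZFSet) (κ : ZFSet) : Prop :=
  IsOrd κ ∧ κ ∈ M ∧ (∃ β ∈ κ, β ∉ M) ∧
    ∀ α : ZFSet, IsOrd α → α ∈ M → (∃ β ∈ α, β ∉ M) → ole κ α

/-- `d` is `(δ, M)`-approximated: `d ∩ Z ∈ M` for every `Z ∈ M` of size `< δ`. -/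
noncomputable def Approx (M : Set ZFSet) (δ : Cardinal.{1}) (d : ZFSet) : Prop :=
  ∀ Z : ZFSet, Z ∈ M → card Z < δ → (d ∩ Z) ∈ M

/-- `d ⊆ X` is `M`-guessed: `d ∩ M = e ∩ M` for some `e ∈ M ∩ P(X)`. -/
def Guessed (M : Set ZFSet) (X d : ZFSet) : Prop :=
  ∃ e : ZFSet, e ∈ M ∧ e ⊆ X ∧ ∀ z ∈ M, (z ∈ e ↔ z ∈ d)

/-- `M` is a `δ`-guessing model: every `(δ,M)`-approximated subset of any `X ∈ M`
is `M`-guessed. -/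
noncomputable def GuessingModel (M : Set ZFSet) (δ : Cardinal.{1}) : Prop :=
  ∀ X ∈ M, ∀ d : ZFSet, d ⊆ X → Approx M δ d → Guessed M X d

/-- `M` is `ℵ₁`-internally unbounded: every countable subset of `M` is contained
in a countable element of `M`. -/
noncomputable def IntUnb (M : Set ZFSet) : Prop :=
  ∀ A : Set ZFSet, A ⊆ M → A.Countable → ∃ z ∈ M, card z ≤ ℵ₀ ∧ A ⊆ z.toSet

universe u

section Stationary

variable {L : Type u} [LinearOrder L]

/-- A set meeting, for every function `h`, the set of points closed under `h`. -/
def IsStat (T : Set L) : Prop := ∀ h : L → L, ∃ a ∈ T, ∀ x < a, h x < a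

theorem IsStat.mono {S T : Set L} (hS : IsStat S) (h : S ⊆ T) : IsStat T := fun g =>
  let ⟨a, ha, hc⟩ := hS g
  ⟨a, h ha, hc⟩

/-- `s` is a cofinal sequence in the set of predecessors of `a`. -/
def IsCofSeq (s : ℕ → L) (a : L) : Prop := (∀ n, s n < a) ∧ ∀ x < a, ∃ n, x < s n

/-- Every small subset of `L` is strictly bounded. -/
def SmallBounded (L : Type u) [LT L] : Prop := ∀ s : Set L, #s < #L → ∃ a, ∀ b ∈ s, b < a

theorem SmallBounded.range {ι : Type*} (hreg : SmallBounded L) (f : ι → L)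
    (h : #(Set.range f) < #L) : ∃ a, ∀ i, f i < a :=
  let ⟨a, ha⟩ := hreg _ h
  ⟨a, fun i => ha _ ⟨i, rfl⟩⟩

theorem SmallBounded.seq (hreg : SmallBounded L) (hunc : ℵ₀ < #L) (f : ℕ → L) :
    ∃ a, ∀ i, f i < a :=
  hreg.range f (lt_of_le_of_lt (mk_le_aleph0_iff.2 (Set.countable_range f).to_subtype) hunc)

theorem SmallBounded.diag (hreg : SmallBounded L) (hinit : ∀ a : L, #(Set.Iic a) < #L)
    (hunc : ℵ₀ < #L) (h : L → L → L) :
    ∃ g : L → L, ∀ x, ∀ c ≤ x, ∀ y ≤ x, h c y < g x := by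
  have : ∀ x, ∃ b, ∀ p : Set.Iic x × Set.Iic x, h p.1 p.2 < b := fun x =>
    hreg.range (fun p : Set.Iic x × Set.Iic x => h p.1 p.2) <| mk_range_le.trans_lt <| by
      rw [mk_prod, lift_id]
      exact mul_lt_of_lt hunc.le (hinit x) (hinit x)
  choose g hg using this
  exact ⟨g, fun x c hc y hy => hg x (⟨c, hc⟩, ⟨y, hy⟩)⟩

/-- Fodor's pressing down lemma. -/
theorem IsStat.exists_fiber (hreg : SmallBounded L) (hinit : ∀ a : L, #(Set.Iic a) < #L)
    (hunc : ℵ₀ < #L) {T : Set L} (hT : IsStat T) (f : L → L) (hf : ∀ a ∈ T, f a < a) :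
    ∃ c, IsStat {a ∈ T | f a = c} := by
  by_contra! hcon
  simp only [IsStat, not_forall, not_exists, not_and] at hcon
  choose h hh using hcon
  obtain ⟨g, hg⟩ := hreg.diag hinit hunc h
  obtain ⟨a, haT, hga⟩ := hT g
  obtain ⟨x, hx, hxa⟩ := hh (f a) a ⟨haT, rfl⟩
  exact hxa <| (hg (max (f a) x) _ (le_max_left _ _) _ (le_max_right _ _)).trans
    (hga _ (max_lt (hf a haT) hx))

theorem isStat_cofSeq [WellFoundedLT L] (hreg : SmallBounded L)
    (hinit : ∀ a : L, #(Set.Iic a) < #L) (hunc : ℵ₀ < #L) :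
    IsStat {a : L | ∃ s, IsCofSeq s a} := by
  intro h
  obtain ⟨g, hg⟩ := hreg.diag hinit hunc fun c y => max c (h y)
  have hne : Nonempty L := by
    rw [← mk_ne_zero_iff]
    exact (aleph0_pos.trans hunc).ne'
  let s : ℕ → L := fun n => g^[n] hne.some
  have hs : ∀ n, ∀ y ≤ s n, max (s n) (h y) < s (n + 1) := fun n y hy => by
    simp only [s, Function.iterate_succ_apply']
    exact hg _ _ le_rfl _ hy
  have hb : {a | ∀ n, s n < a}.Nonempty := hreg.seq hunc s
  let a := wellFounded_lt.min _ hb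
  have ha : ∀ n, s n < a := wellFounded_lt.min_mem _ hb
  have hcof : ∀ x < a, ∃ n, x < s n := by
    intro x hx
    by_contra! hcon
    refine wellFounded_lt.not_lt_min {a | ∀ n, s n < a} (x := x) (fun n => ?_) hx
    exact ((le_max_left _ _).trans_lt (hs n _ le_rfl)).trans_le (hcon (n + 1))
  refine ⟨a, ⟨s, ha, hcof⟩, fun x hx => ?_⟩
  obtain ⟨n, hn⟩ := hcof x hx
  exact ((le_max_right _ _).trans_lt (hs n x hn.le)).trans (ha _)

/-- Solovay's splitting theorem for points of countable cofinality. -/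
theorem exists_splitting [WellFoundedLT L] (hreg : SmallBounded L)
    (hinit : ∀ a : L, #(Set.Iic a) < #L) (hunc : ℵ₀ < #L) :
    ∃ F : L → L, ∀ b, IsStat {a : L | (∃ s, IsCofSeq s a) ∧ F a = b} := by
  classical
  have hS := isStat_cofSeq hreg hinit hunc
  have hch : ∀ a : L, ∃ s : ℕ → L, (∃ s, IsCofSeq s a) → IsCofSeq s a := fun a => by
    by_cases h : ∃ s, IsCofSeq s a
    · exact ⟨h.choose, fun _ => h.choose_spec⟩
    · exact ⟨fun _ => a, fun h' => (h h').elim⟩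
  choose s hs using hch
  obtain ⟨n, hn⟩ : ∃ n, ∀ e, IsStat {a : L | (∃ s, IsCofSeq s a) ∧ e ≤ s a n} := by
    by_contra! hcon
    choose e he using hcon
    simp only [IsStat, not_forall, not_exists, not_and] at he
    choose h hh using he
    obtain ⟨b, hb⟩ := hreg.seq hunc e
    have hsup : ∀ x, ∃ c, ∀ n, h n x < c := fun x => hreg.seq hunc fun n => h n x
    choose g hg using hsup
    obtain ⟨a, haS, ha⟩ := hS fun x => max b (g x)
    have hsa := hs a haS
    have hba : b < a := (le_max_left _ _).trans_lt (ha _ (hsa.1 0))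
    obtain ⟨n, hn⟩ := hsa.2 b hba
    obtain ⟨x, hx, hxa⟩ := hh n a ⟨haS, ((hb n).trans hn).le⟩
    exact hxa <| (hg x n).trans ((le_max_right _ _).trans_lt (ha x hx))
  let G : Set L := {c | IsStat {a : L | (∃ s, IsCofSeq s a) ∧ s a n = c}}
  have hG : ∀ e, ∃ c ∈ G, e ≤ c := fun e => by
    obtain ⟨c, hc⟩ := (hn e).exists_fiber hreg hinit hunc (fun a => s a n)
      fun a ha => (hs a ha.1).1 n
    refine ⟨c, hc.mono fun a ha => ⟨ha.1.1, ha.2⟩, ?_⟩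
    obtain ⟨a, ha, -⟩ := hc id
    exact ha.2 ▸ ha.1.2
  have hcard : #G = #L := (mk_set_le G).eq_of_not_lt fun hlt => by
    obtain ⟨a, ha⟩ := hreg G hlt
    obtain ⟨c, hc, hac⟩ := hG a
    exact (ha c hc).not_ge hac
  obtain ⟨E⟩ := Cardinal.eq.1 hcard
  refine ⟨fun a => if h : s a n ∈ G then E ⟨_, h⟩ else a, fun b => ?_⟩
  refine IsStat.mono (E.symm b).2 fun a ha => ⟨ha.1, ?_⟩
  have hmem : s a n ∈ G := ha.2 ▸ (E.symm b).2
  have : (⟨s a n, hmem⟩ : G) = E.symm b := Subtype.ext ha.2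
  simp only [dif_pos hmem]
  rw [this, E.apply_symm_apply]

/-- A function each of whose fibers contains limits of `ω`-sequences from each unbounded set. -/
theorem exists_seq_splitting [WellFoundedLT L] (hreg : SmallBounded L)
    (hinit : ∀ a : L, #(Set.Iic a) < #L) (hunc : ℵ₀ < #L) :
    ∃ F : L → L, ∀ b, ∀ A : Set L, (∀ x, ∃ y ∈ A, x < y) →
      ∃ a, b < a ∧ F a = b ∧ ∃ s, IsCofSeq s a ∧ StrictMono s ∧ ∀ n, s n ∈ A := by
  obtain ⟨F, hF⟩ := exists_splitting hreg hinit hunc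
  refine ⟨F, fun b A hA => ?_⟩
  choose g hgA hg using hA
  obtain ⟨a, ⟨⟨s, hs⟩, hFa⟩, ha⟩ := hF b fun x => max b (g x)
  let t : ℕ → L := fun n => n.rec (g (s 0)) fun k y => g (max y (s (k + 1)))
  have htA : ∀ n, t n ∈ A := by rintro (_ | n) <;> exact hgA _
  have hga : ∀ x < a, g x < a := fun x hx => (le_max_right _ _).trans_lt (ha x hx)
  have hta : ∀ n, t n < a := by
    intro n
    induction n with
    | zero => exact hga _ (hs.1 0)
    | succ k ih => exact hga _ (max_lt ih (hs.1 _))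
  have hst : ∀ n, s n < t n := by
    rintro (_ | n)
    · exact hg _
    · exact (le_max_right _ _).trans_lt (hg _)
  refine ⟨a, (le_max_left _ _).trans_lt (ha _ (hs.1 0)), hFa, t, ⟨hta, fun x hx => ?_⟩,
    strictMono_nat_of_lt_succ fun n => (le_max_left _ _).trans_lt (hg _), htA⟩
  obtain ⟨n, hn⟩ := hs.2 x hx
  exact ⟨n, hn.trans (hst n)⟩

end Stationary

section Formulas

variable {S : Set ZFSet} {n : ℕ}

/-- Universal quantification. -/
def SF.all (f : SF (n + 1)) : SF n := .not (.ex (.not f))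

/-- Conjunction. -/
def SF.and (f g : SF n) : SF n := .not (.imp f (.not g))

theorem realize_mem (i j : Fin n) (v : Fin n → ZFSet) :
    Realize S (.mem i j) v ↔ v i ∈ v j := Iff.rfl

theorem realize_eq (i j : Fin n) (v : Fin n → ZFSet) :
    Realize S (.eq i j) v ↔ v i = v j := Iff.rfl

theorem realize_imp (f g : SF n) (v : Fin n → ZFSet) :
    Realize S (.imp f g) v ↔ (Realize S f v → Realize S g v) := Iff.rfl

theorem realize_not (f : SF n) (v : Fin n → ZFSet) :
    Realize S (.not f) v ↔ ¬ Realize S f v := Iff.rfl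

theorem realize_ex (f : SF (n + 1)) (v : Fin n → ZFSet) :
    Realize S (.ex f) v ↔ ∃ x ∈ S, Realize S f (Matrix.vecCons x v) := Iff.rfl

theorem realize_all (f : SF (n + 1)) (v : Fin n → ZFSet) :
    Realize S (.all f) v ↔ ∀ x ∈ S, Realize S f (Matrix.vecCons x v) := by
  simp [SF.all, realize_not, realize_ex]

theorem realize_and (f g : SF n) (v : Fin n → ZFSet) :
    Realize S (.and f g) v ↔ Realize S f v ∧ Realize S g v := by
  simp [SF.and, realize_not, realize_imp]

/-- `b ∈ a` and `{a, b}` is covered by a member of `F`. -/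
def Rel (S : Set ZFSet) (F a b : ZFSet) : Prop := b ∈ a ∧ ∃ p ∈ S, p ∈ F ∧ a ∈ p ∧ b ∈ p

/-- The formula defining `Rel`. -/
def SF.rel (F a b : Fin n) : SF n :=
  .and (.mem b a) (.ex (.and (.mem 0 F.succ) (.and (.mem a.succ 0) (.mem b.succ 0))))

theorem realize_rel (F a b : Fin n) (v : Fin n → ZFSet) :
    Realize S (.rel F a b) v ↔ Rel S (v F) (v a) (v b) := by
  simp [SF.rel, Rel, realize_mem, realize_and, realize_ex]

/-- `d ∩ x` is empty or has a largest element. -/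
def HasMax (S : Set ZFSet) (d x : ZFSet) : Prop :=
  (∃ z ∈ S, z ∈ d ∧ z ∈ x) →
    ∃ y ∈ S, y ∈ d ∧ y ∈ x ∧ ∀ z ∈ S, z ∈ d → z ∈ x → z ∉ y → z = y

/-- The formula defining `HasMax`. -/
def SF.hasMax (d x : Fin n) : SF n :=
  .imp (.ex (.and (.mem 0 d.succ) (.mem 0 x.succ)))
    (.ex (.and (.mem 0 d.succ) (.and (.mem 0 x.succ)
      (.all (.imp (.mem 0 d.succ.succ) (.imp (.mem 0 x.succ.succ)
        (.imp (.not (.mem 0 1)) (.eq 0 1))))))))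

theorem realize_hasMax (d x : Fin n) (v : Fin n → ZFSet) :
    Realize S (.hasMax d x) v ↔ HasMax S (v d) (v x) := by
  simp [SF.hasMax, HasMax, realize_mem, realize_and, realize_ex, realize_all, realize_imp,
    realize_not, realize_eq]

/-- `F` codes a partial function whose fibers over members of `l` contain limits of
discrete cofinal subsets of every unbounded subset of `l`. -/
def Splits (S : Set ZFSet) (F l : ZFSet) : Prop :=
  (∀ a ∈ S, ∀ b ∈ S, ∀ c ∈ S, Rel S F a b → Rel S F a c → b = c) ∧
  ∀ b ∈ S, ∀ A ∈ S, b ∈ l → (∀ x ∈ S, x ∈ l → ∃ y ∈ S, y ∈ A ∧ y ∈ l ∧ x ∈ y) →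
    ∃ a ∈ S, ∃ d ∈ S, a ∈ l ∧ Rel S F a b ∧ (∃ z ∈ S, z ∈ d) ∧
      (∀ z ∈ S, z ∈ d → z ∈ A ∧ z ∈ a) ∧ (∀ x ∈ S, x ∈ a → ∃ y ∈ S, y ∈ d ∧ x ∈ y) ∧
      ∀ x ∈ S, x ∈ a → HasMax S d x

/-- The formula defining `Splits`. -/
def SF.splits : SF 2 :=
  .and (.all (.all (.all (.imp (.rel 3 2 1) (.imp (.rel 3 2 0) (.eq 1 0))))))
    (.all (.all (.imp (.mem 1 3)
      (.imp (.all (.imp (.mem 0 4) (.ex (.and (.mem 0 2) (.and (.mem 0 5) (.mem 1 0))))))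
        (.ex (.ex (.and (.mem 1 5) (.and (.rel 4 1 3) (.and (.ex (.mem 0 1))
          (.and (.all (.imp (.mem 0 1) (.and (.mem 0 3) (.mem 0 2))))
            (.and (.all (.imp (.mem 0 2) (.ex (.and (.mem 0 2) (.mem 1 0)))))
              (.all (.imp (.mem 0 2) (.hasMax 1 0))))))))))))))

theorem realize_splits (F l : ZFSet) : Realize S .splits ![F, l] ↔ Splits S F l := by
  simp [SF.splits, Splits, realize_mem, realize_and, realize_ex, realize_all, realize_imp,
    realize_eq, realize_rel, realize_hasMax]

end Formulas

section Elementarity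

variable {M R : Set ZFSet}

theorem Prec.exists_mem (hM : Prec M R) {n : ℕ} (f : SF (n + 1)) (v : Fin n → ZFSet)
    (hv : ∀ i, v i ∈ M) (h : ∃ x ∈ R, Realize R f (Matrix.vecCons x v)) :
    ∃ x ∈ M, Realize R f (Matrix.vecCons x v) := by
  obtain ⟨x, hx, hf⟩ := (hM.2 (.ex f) v hv).2 h
  exact ⟨x, hx, (hM.2 f _ (Fin.cases hx hv)).1 hf⟩

theorem Prec.sdiff_mem (hM : Prec M R) (hR : ∀ x ∈ R, ∀ y ∈ x, y ∈ R) {Z z Y : ZFSet}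
    (hZ : Z ∈ M) (hz : z ∈ M) (hY : Y ∈ R) (h : ∀ t, t ∈ Y ↔ t ∈ Z ∧ t ≠ z) : Y ∈ M := by
  obtain ⟨W, hW, hf⟩ := hM.exists_mem (.all (.and (.imp (.mem 0 1) (.and (.mem 0 2)
    (.not (.eq 0 3)))) (.imp (.and (.mem 0 2) (.not (.eq 0 3))) (.mem 0 1)))) ![Z, z]
    (by simp [Fin.forall_fin_succ, hZ, hz]) ⟨Y, hY, by
      simp +contextual [realize_all, realize_and, realize_imp, realize_mem, realize_not,
        realize_eq, h]⟩
  simp only [realize_all, realize_and, realize_imp, realize_mem, realize_not, realize_eq] at hf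
  suffices Y = W from this ▸ hW
  ext t
  rw [h]
  exact ⟨fun ht => (hf t (hR _ (hM.1 hZ) _ ht.1)).2 ht,
    fun ht => (hf t (hR _ (hM.1 hW) _ ht)).1 ht⟩

theorem Prec.insert_mem (hM : Prec M R) (hR : ∀ x ∈ R, ∀ y ∈ x, y ∈ R) {Z z Y : ZFSet}
    (hZ : Z ∈ M) (hz : z ∈ M) (hY : Y ∈ R) (h : ∀ t, t ∈ Y ↔ t ≠ z → t ∈ Z) : Y ∈ M := by
  obtain ⟨W, hW, hf⟩ := hM.exists_mem (.all (.and (.imp (.mem 0 1) (.imp (.not (.eq 0 3))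
    (.mem 0 2))) (.imp (.imp (.not (.eq 0 3)) (.mem 0 2)) (.mem 0 1)))) ![Z, z]
    (by simp [Fin.forall_fin_succ, hZ, hz]) ⟨Y, hY, by
      simp +contextual [realize_all, realize_and, realize_imp, realize_mem, realize_not,
        realize_eq, h]⟩
  simp only [realize_all, realize_and, realize_imp, realize_mem, realize_not, realize_eq] at hf
  suffices Y = W from this ▸ hW
  ext t
  exact ⟨fun ht => (hf t (hR _ hY _ ht)).2 ((h t).1 ht),
    fun ht => (h t).2 ((hf t (hR _ (hM.1 hW) _ ht)).1 ht)⟩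

/-- Finite elements of `M`, together with their subsets, are included in `M`. -/
theorem Prec.finite_subset (hM : Prec M R) (hR : ∀ x ∈ R, ∀ y ∈ x, y ∈ R)
    (hsub : ∀ x ∈ R, ∀ y, y ⊆ x → y ∈ R) {Z : ZFSet} (hZ : Z ∈ M) (hfin : Z.toSet.Finite) :
    (∀ x ∈ Z, x ∈ M) ∧ ∀ W, W ⊆ Z → W ∈ M := by
  induction hn : Z.toSet.ncard generalizing Z with
  | zero =>
    have hemp : Z.toSet = ∅ := (Set.ncard_eq_zero hfin).1 hn
    have hZe : ∀ x, x ∉ Z := fun x hx => Set.notMem_empty x (hemp ▸ hx : x ∈ (∅ : Set ZFSet))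
    refine ⟨fun x hx => (hZe x hx).elim, fun W hW => ?_⟩
    have : W = Z := by
      ext x
      exact ⟨fun hx => hW hx, fun hx => (hZe x hx).elim⟩
    exact this ▸ hZ
  | succ k ih =>
    obtain ⟨x₀, hx₀⟩ : Z.toSet.Nonempty := Set.nonempty_of_ncard_ne_zero (by omega)
    obtain ⟨z, hz, hzZ⟩ := hM.exists_mem (.mem 0 1) ![Z] (by simp [hZ])
      ⟨x₀, hR _ (hM.1 hZ) _ hx₀, hx₀⟩
    replace hzZ : z ∈ Z := hzZ
    have hsep : ∀ W : ZFSet, ∀ t, t ∈ W.sep (· ≠ z) ↔ t ∈ W ∧ t ≠ z := fun W t => ZFSet.mem_sep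
    have hZ' : Z.sep (· ≠ z) ∈ M := hM.sdiff_mem hR hZ hz
      (hsub _ (hM.1 hZ) _ ZFSet.sep_subset) (hsep Z)
    have hset : (Z.sep (· ≠ z)).toSet = Z.toSet \ {z} := by
      ext t
      exact hsep Z t
    obtain ⟨h1, h2⟩ := ih hZ' (hset ▸ hfin.sdiff) (by
      rw [hset, Set.ncard_sdiff_singleton_of_mem (s := Z.toSet) hzZ, hn, Nat.add_sub_cancel])
    refine ⟨fun x hx => ?_, fun W hW => ?_⟩
    · by_cases hxz : x = z
      · exact hxz ▸ hz
      · exact h1 x ((hsep Z x).2 ⟨hx, hxz⟩)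
    · have hW' : W.sep (· ≠ z) ∈ M := h2 _ fun t ht =>
        (hsep Z t).2 ⟨hW ((hsep W t).1 ht).1, ((hsep W t).1 ht).2⟩
      by_cases hzW : z ∈ W
      · refine hM.insert_mem hR hW' hz (hsub _ (hM.1 hZ) _ hW) fun t => ?_
        rw [hsep]
        refine ⟨fun ht htz => ⟨ht, htz⟩, fun ht => ?_⟩
        by_cases htz : t = z
        · exact htz ▸ hzW
        · exact (ht htz).1
      · have : W.sep (· ≠ z) = W := by
          ext t
          rw [hsep]
          exact ⟨fun ht => ht.1, fun ht => ⟨ht, fun htz => hzW (htz ▸ ht)⟩⟩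
        exact this ▸ hW'

end Elementarity

section HereditarySize

theorem IsOrd.isOrdinal {x : ZFSet} (h : IsOrd x) : x.IsOrdinal :=
  ZFSet.isOrdinal_iff_forall_mem_isTransitive.2 h

variable {θ : ZFSet.{u}}

theorem HSet.mem_of_mem {x y : ZFSet.{u}} (hx : x ∈ HSet θ) (hy : y ∈ x) : y ∈ HSet θ :=
  (mk_le_mk_of_subset (show tcl y ⊆ tcl x from fun _ hz => .tail hz hy)).trans_lt hx

theorem HSet.mem_of_subset {x y : ZFSet.{u}} (hx : x ∈ HSet θ) (hy : y ⊆ x) : y ∈ HSet θ := by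
  refine (mk_le_mk_of_subset fun z hz => ?_).trans_lt hx
  rcases hz with hz | ⟨hz, hw⟩
  · exact .single (hy hz)
  · exact .tail hz (hy hw)

theorem HSet.card_lt {x : ZFSet.{u}} (hx : x ∈ HSet θ) : card x < card θ :=
  (mk_le_mk_of_subset fun _ hz => Relation.TransGen.single hz).trans_lt hx

/-- A family of at most `card x` sets whose elements lie in `x` belongs to `HSet θ`. -/
theorem HSet.mem_of_family {x y : ZFSet.{u}} (hx : x ∈ HSet θ) (hinf : ℵ₀ ≤ card θ)
    (hy : ∀ p ∈ y, p ⊆ x) (hcard : card y ≤ card x) : y ∈ HSet θ := by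
  have hsub : tcl y ⊆ y.toSet ∪ tcl x := by
    intro z hz
    rcases hz with hz | ⟨hz, hw⟩
    · exact Or.inl hz
    · right
      rcases hz with hz | ⟨hz, hw'⟩
      · exact .single (hy _ hw hz)
      · exact .tail hz (hy _ hw hw')
  exact (mk_le_mk_of_subset hsub).trans_lt <| (mk_union_le _ _).trans_lt <|
    add_lt_of_lt hinf (hcard.trans_lt (HSet.card_lt hx)) hx

/-- The elements of a set, as a type without the order inherited from `⊆`. -/
def Elts (x : ZFSet.{u}) : Type (u + 1) := {y // y ∈ x}

/-- The underlying set of a member of `Elts x`. -/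
def Elts.val {x : ZFSet.{u}} (a : Elts x) : ZFSet.{u} := a.1

theorem Elts.val_injective {x : ZFSet.{u}} : Function.Injective (Elts.val (x := x)) :=
  Subtype.val_injective

theorem exists_splits {l : ZFSet.{u}} (hl : IsRegCard l) (hunc : ℵ₀ < card l)
    (hlθ : l ∈ HSet θ) : ∃ F ∈ HSet θ, Splits (HSet θ) F l := by
  classical
  have hord : l.IsOrdinal := hl.1.1.isOrdinal
  have : IsWellOrder (Elts l) fun a b : Elts l => a.1 ∈ b.1 := hord.isWellOrder
  let : LinearOrder (Elts l) := linearOrderOfSTO fun a b : Elts l => a.1 ∈ b.1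
  have : Small.{u} (Elts l) := ZFSet.small_coe l
  have : WellFoundedLT (Elts l) :=
    ⟨(IsWellFounded.wf : WellFounded fun a b : Elts l => a.1 ∈ b.1)⟩
  have hreg : SmallBounded (Elts l) := by
    intro s hs
    by_contra! hcon
    have hcof : CofinalSetIn (Elts.val '' s) l := by
      refine ⟨?_, fun b hb => ?_⟩
      · rintro _ ⟨x, -, rfl⟩
        exact x.2
      · obtain ⟨c, hc, hbc⟩ := hcon ⟨b, hb⟩
        refine ⟨c.1, ⟨c, hc, rfl⟩, ?_⟩
        rcases hbc.lt_or_eq with h | h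
        · exact Or.inl h
        · exact Or.inr (congrArg Elts.val h)
    have := hl.2.2 _ hcof
    exact hs.ne ((mk_image_eq Elts.val_injective).symm.trans this)
  have hinit : ∀ a : Elts l, #(Set.Iic a) < #(Elts l) := by
    intro a
    have hsub : Elts.val '' Set.Iic a ⊆ insert a.1 a.1.toSet := by
      rintro _ ⟨x, hx, rfl⟩
      rcases (show x ≤ a from hx).lt_or_eq with h | h
      · exact Or.inr h
      · exact Or.inl (congrArg Elts.val h)
    rw [← mk_image_eq (s := Set.Iic a) Elts.val_injective]
    exact (mk_le_mk_of_subset hsub).trans_lt <| mk_insert_le.trans_lt <|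
      add_lt_of_lt hunc.le (hl.1.2 _ a.2) (one_lt_aleph0.trans hunc)
  obtain ⟨F, hF⟩ := exists_seq_splitting hreg hinit hunc
  let P : ZFSet := ZFSet.range fun a : Elts l => ({a.1, (min a (F a)).1} : ZFSet)
  have hP : P ∈ HSet θ := by
    refine HSet.mem_of_family hlθ (hunc.le.trans (HSet.card_lt hlθ).le) (fun p hp => ?_) ?_
    · obtain ⟨a, rfl⟩ := ZFSet.mem_range.1 hp
      intro z hz
      rcases ZFSet.mem_pair.1 hz with rfl | rfl
      · exact a.2
      · exact (min a (F a)).2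
    · have : P.toSet = Set.range fun a : Elts l => ({a.1, (min a (F a)).1} : ZFSet) :=
        ZFSet.coe_range _
      rw [card, this]
      exact mk_range_le
  have hrel : ∀ a b, Rel (HSet θ) P a b ↔
      ∃ (ha : a ∈ l) (hb : b ∈ l), b ∈ a ∧ F ⟨a, ha⟩ = ⟨b, hb⟩ := by
    refine fun a b => ⟨?_, ?_⟩
    · rintro ⟨hba, p, -, hp, hap, hbp⟩
      obtain ⟨c, rfl⟩ := ZFSet.mem_range.1 hp
      rcases ZFSet.mem_pair.1 hap with rfl | rfl <;> rcases ZFSet.mem_pair.1 hbp with rfl | rfl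
      · exact (ZFSet.mem_irrefl _ hba).elim
      · refine ⟨c.2, (min c (F c)).2, hba, ?_⟩
        have : min c (F c) < c := hba
        exact (min_eq_right (le_of_not_ge fun h => this.ne (min_eq_left h))).symm
      · exact ((min_le_left c (F c)).not_gt hba).elim
      · exact (ZFSet.mem_irrefl _ hba).elim
    · rintro ⟨ha, hb, hba, hFa⟩
      have hp : ({a, (min ⟨a, ha⟩ (F ⟨a, ha⟩) : Elts l).1} : ZFSet) ∈ P :=
        ZFSet.mem_range.2 ⟨⟨a, ha⟩, rfl⟩
      refine ⟨hba, _, HSet.mem_of_mem hP hp, hp, ZFSet.mem_pair.2 (Or.inl rfl),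
        ZFSet.mem_pair.2 (Or.inr ?_)⟩
      have hlt : @LT.lt (Elts l) _ ⟨b, hb⟩ ⟨a, ha⟩ := hba
      rw [hFa, min_eq_right hlt.le]
  refine ⟨P, hP, ?_, ?_⟩
  · intro a _ b _ c _ hab hac
    obtain ⟨ha, hb, -, h1⟩ := (hrel a b).1 hab
    obtain ⟨_, hc, -, h2⟩ := (hrel a c).1 hac
    exact congrArg Elts.val (h1.symm.trans h2)
  · intro b _ A _ hb hunb
    obtain ⟨a, hba, hFa, s, hs, hmono, hsA⟩ := hF ⟨b, hb⟩ {y | y.1 ∈ A} fun x => by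
      obtain ⟨y, -, hyA, hyl, hxy⟩ := hunb x.1 (HSet.mem_of_mem hlθ x.2) x.2
      exact ⟨⟨y, hyl⟩, hyA, hxy⟩
    have hinH : ∀ y : Elts l, y.1 ∈ HSet θ := fun y => HSet.mem_of_mem hlθ y.2
    have hal : ∀ x ∈ a.1, x ∈ l := fun x hx => hord.mem_trans hx a.2
    refine ⟨a.1, hinH a, ZFSet.sep (fun y => ∃ n, (s n).1 = y) l,
      HSet.mem_of_subset hlθ ZFSet.sep_subset, a.2, (hrel _ _).2 ⟨a.2, hb, hba, hFa⟩,
      ⟨(s 0).1, hinH _, ZFSet.mem_sep.2 ⟨(s 0).2, 0, rfl⟩⟩, fun z _ hz => ?_, fun x _ hx => ?_,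
      fun x _ hx => ?_⟩
    · obtain ⟨-, n, rfl⟩ := ZFSet.mem_sep.1 hz
      exact ⟨hsA n, hs.1 n⟩
    · obtain ⟨n, hn⟩ := hs.2 ⟨x, hal x hx⟩ hx
      exact ⟨(s n).1, hinH _, ZFSet.mem_sep.2 ⟨(s n).2, n, rfl⟩, hn⟩
    · rintro ⟨z, -, hz, hzx⟩
      obtain ⟨-, k, rfl⟩ := ZFSet.mem_sep.1 hz
      let x' : Elts l := ⟨x, hal x hx⟩
      obtain ⟨N, hN⟩ := hs.2 x' hx
      let n := Nat.findGreatest (fun n => s n < x') N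
      have hkN : k ≤ N := le_of_lt (hmono.lt_iff_lt.1 (lt_trans (show s k < x' from hzx) hN))
      have hn : s n < x' := Nat.findGreatest_spec (P := fun n => s n < x') hkN hzx
      refine ⟨(s n).1, hinH _, ZFSet.mem_sep.2 ⟨(s n).2, n, rfl⟩, hn, fun z _ hz hzx hzn => ?_⟩
      obtain ⟨-, m, rfl⟩ := ZFSet.mem_sep.1 hz
      have hmN : m ≤ N := le_of_lt (hmono.lt_iff_lt.1 (lt_trans (show s m < x' from hzx) hN))
      have hmn : m ≤ n := Nat.le_findGreatest (P := fun n => s n < x') hmN hzx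
      refine congrArg Elts.val (le_antisymm (hmono.monotone hmn) (not_lt.1 hzn))

end HereditarySize

/-- Proposition 7.3: if `M ≺ H_θ` is an `ℵ₀`-guessing model then `M ∩ λ` is
bounded in `λ` for every regular `λ ∈ M` with `κ_M < λ < θ`. -/
theorem inter_bounded (θ : ZFSet) (hθ : IsRegCard θ)
    (M : Set ZFSet) (hM : Prec M (HSet θ)) (κ : ZFSet) (hκ : KappaSpec M κ)
    (hG : GuessingModel M ℵ₀)
    (lam : ZFSet) (hlamM : lam ∈ M) (hlamreg : IsRegCard lam)
    (hκlam : κ ∈ lam) (hlamθ : lam ∈ HSet θ) :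
    ∃ β, β ∈ lam ∧ ∀ x, x ∈ M → x ∈ lam → ole x β := by
  by_contra! hcon
  have hord : lam.IsOrdinal := hlamreg.1.1.isOrdinal
  have htrans : ∀ x ∈ HSet θ, ∀ y ∈ x, y ∈ HSet θ := fun _ hx _ hy => HSet.mem_of_mem hx hy
  have hsub : ∀ x ∈ HSet θ, ∀ y, y ⊆ x → y ∈ HSet θ := fun _ hx _ hy => HSet.mem_of_subset hx hy
  obtain ⟨-, hκM, ⟨β, hβκ, hβM⟩, -⟩ := hκ
  have hunc : ℵ₀ < card lam := by
    refine lt_of_not_ge (fun h => hβM ?_)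
    exact (hM.finite_subset htrans hsub hκM
      (lt_aleph0_iff_set_finite.1 ((hlamreg.1.2 _ hκlam).trans_le h))).1 β hβκ
  have hβl : β ∈ lam := hord.mem_trans hβκ hκlam
  have hunb : ∀ x ∈ lam, ∃ y ∈ M, y ∈ lam ∧ x ∈ y := by
    intro x hx
    obtain ⟨y, hyM, hyl, hxy⟩ := hcon x hx
    refine ⟨y, hyM, hyl, ?_⟩
    rcases (hord.mem hx).mem_trichotomous (hord.mem hyl) with h | h | h
    · exact h
    · exact (hxy (Or.inr h.symm)).elim
    · exact (hxy (Or.inl h)).elim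
  obtain ⟨F, hFM, hF⟩ : ∃ F ∈ M, Splits (HSet θ) F lam := by
    obtain ⟨F, hF, hs⟩ := exists_splits hlamreg hunc hlamθ
    obtain ⟨F', hF', hs'⟩ := hM.exists_mem .splits ![lam] (by simp [hlamM])
      ⟨F, hF, (realize_splits F lam).2 hs⟩
    exact ⟨F', hF', (realize_splits F' lam).1 hs'⟩
  have hA : ∀ y, y ∈ lam.sep (· ∈ M) ↔ y ∈ lam ∧ y ∈ M := fun y => ZFSet.mem_sep
  obtain ⟨α, hαH, d, hdH, hαl, hrel, ⟨z₀, -, hz₀⟩, hdA, hdcof, hdmax⟩ :=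
    hF.2 β (htrans _ hlamθ _ hβl) (lam.sep (· ∈ M)) (hsub _ hlamθ _ ZFSet.sep_subset) hβl
      fun x _ hx => by
        obtain ⟨y, hyM, hyl, hxy⟩ := hunb x hx
        exact ⟨y, hM.1 hyM, (hA y).2 ⟨hyl, hyM⟩, hyl, hxy⟩
  replace hdA : ∀ z ∈ d, (z ∈ lam ∧ z ∈ M) ∧ z ∈ α := fun z hz =>
    ⟨(hA z).1 (hdA z (htrans _ hdH _ hz) hz).1, (hdA z (htrans _ hdH _ hz) hz).2⟩
  obtain ⟨e, heM, -, hed⟩ := hG lam hlamM d (fun z hz => (hdA z hz).1.1) fun Z hZ hfin =>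
    (hM.finite_subset htrans hsub hZ (lt_aleph0_iff_set_finite.1 hfin)).2 _
      fun z hz => (ZFSet.mem_inter.1 hz).2
  have hαM : α ∉ M := fun hαM => by
    obtain ⟨γ, hγM, hγ⟩ := hM.exists_mem (.rel 2 1 0) ![α, F]
      (by simp [Fin.forall_fin_succ, hαM, hFM]) ⟨β, htrans _ hlamθ _ hβl,
        (realize_rel _ _ _ _).2 hrel⟩
    have := hF.1 α hαH β (htrans _ hlamθ _ hβl) γ (hM.1 hγM) hrel ((realize_rel _ _ _ _).1 hγ)
    exact hβM (this ▸ hγM)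
  have hne : {x | x ∈ M ∧ x ∈ lam ∧ α ∈ x}.Nonempty := hunb α hαl
  obtain ⟨hρM, hρl, hαρ⟩ := ZFSet.mem_wf.min_mem _ hne
  have hρmin : ∀ x, x ∈ M → x ∈ lam → α ∈ x → x ∉ ZFSet.mem_wf.min _ hne :=
    fun x h1 h2 h3 => ZFSet.mem_wf.not_lt_min {x | x ∈ M ∧ x ∈ lam ∧ α ∈ x} ⟨h1, h2, h3⟩
  generalize ZFSet.mem_wf.min _ hne = ρ at *
  have hmax : Realize M (.all (.imp (.mem 0 2) (.hasMax 1 0))) ![e, ρ] := by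
    simp only [realize_all, realize_imp, realize_mem, realize_hasMax]
    rintro x hxM hxρ ⟨z, hzM, hze, hzx⟩
    have hxl : x ∈ lam := hord.mem_trans hxρ hρl
    have hxα : x ∈ α := by
      rcases (hord.mem hxl).mem_trichotomous (hord.mem hαl) with h | h | h
      · exact h
      · exact (hαM (h ▸ hxM)).elim
      · exact (hρmin x hxM hxl h hxρ).elim
    obtain ⟨y, -, hyd, hyx, hy⟩ := hdmax x (hM.1 hxM) hxα ⟨z, hM.1 hzM, (hed z hzM).1 hze, hzx⟩
    have hyM : y ∈ M := (hdA y hyd).1.2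
    exact ⟨y, hyM, (hed y hyM).2 hyd, hyx, fun t htM hte => hy t (hM.1 htM) ((hed t htM).1 hte)⟩
  replace hmax := (hM.2 _ ![e, ρ] (by simp [Fin.forall_fin_succ, heM, hρM])).1 hmax
  simp only [realize_all, realize_imp, realize_mem, realize_hasMax] at hmax
  have hde : ∀ z ∈ d, z ∈ e := fun z hz => (hed z (hdA z hz).1.2).2 hz
  obtain ⟨y, hyH, -, hyα, hy⟩ := hmax α hαH hαρ
    ⟨z₀, htrans _ hdH _ hz₀, hde _ hz₀, (hdA _ hz₀).2⟩
  obtain ⟨z, hzH, hzd, hyz⟩ := hdcof y hyH hyα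
  have hzy := hy z hzH (hde z hzd) (hdA z hzd).2 (ZFSet.mem_asymm hyz)
  exact ZFSet.mem_irrefl _ (hzy ▸ hyz)

end GuessingModels
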